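/- Let d ∈ ℕ, T > 0, σ > 0, r > 0, and let g : ℝ^d → ℝ be bounded and continuous. Let γ^d be the standard Gaussian measure on ℝ^d (the d-fold product of the Gaussian measure on ℝ with mean 0 and variance 1). Define v : [0,T] × ℝ^d → ℝ by v(t,x) := −r σ² log ( ∫_{ℝ^d} exp( −(1/(r σ²)) g(x + σ√(T−t)·y) ) dγ^d(y) ). Then v is continuous on [0,T] × ℝ^d, v is differentiable in t and twice continuously differentiable in x on [0,T) × ℝ^d, v satisfies the Hamilton–Jacobi–Bellman equation ∂_t v(t,x) + (σ²/2) Δ_x v(t,x) − (1/(2r)) ‖∇_x v(t,x)‖² = 0 for all (t,x) ∈ [0,T) × ℝ^d, and v(T,x) = g(x) for all x ∈ ℝ^d. -/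

import Mathlib

open MeasureTheory ProbabilityTheory

/-- The `i`-th partial derivative of `f : ℝ^d → ℝ` at `x`. -/
noncomputable def pderiv' (d : ℕ) (f : (Fin d → ℝ) → ℝ) (x : Fin d → ℝ) (i : Fin d) : ℝ :=
  fderiv ℝ f x (Pi.single i 1)

/-- The spatial Laplacian of `f : ℝ^d → ℝ` at `x` (trace of the Hessian). -/
noncomputable def lap' (d : ℕ) (f : (Fin d → ℝ) → ℝ) (x : Fin d → ℝ) : ℝ :=
  ∑ i : Fin d, fderiv ℝ (fun y => fderiv ℝ f y (Pi.single i 1)) x (Pi.single i 1)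

/-- The standard Gaussian measure on `ℝ^d`. -/
noncomputable def stdGaussian (d : ℕ) : Measure (Fin d → ℝ) :=
  Measure.pi fun _ : Fin d => gaussianReal 0 1

/-- A polynomial multiple `P(y) exp(-|y|² / 2)` of the unnormalised Gaussian density on `ℝ^d`. -/
noncomputable def gaussPoly {d : ℕ} (P : MvPolynomial (Fin d) ℝ) (y : Fin d → ℝ) : ℝ :=
  MvPolynomial.eval y P * Real.exp (-(∑ i, y i ^ 2) / 2)

/-- The operator on polynomials corresponding to `∂_i` acting on `gaussPoly`. -/
noncomputable def gaussDeriv {d : ℕ} (i : Fin d) (P : MvPolynomial (Fin d) ℝ) :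
    MvPolynomial (Fin d) ℝ :=
  MvPolynomial.pderiv i P - MvPolynomial.X i * P

lemma continuous_gaussPoly {d : ℕ} (P : MvPolynomial (Fin d) ℝ) : Continuous (gaussPoly P) := by
  unfold gaussPoly
  have := MvPolynomial.continuous_eval P
  fun_prop

lemma MvPolynomial.exists_abs_eval_le {d : ℕ} (P : MvPolynomial (Fin d) ℝ) :
    ∃ C : ℝ, 0 ≤ C ∧ ∃ n : ℕ, ∀ y : Fin d → ℝ, |MvPolynomial.eval y P| ≤ C * (1 + ‖y‖) ^ n := by
  induction P using MvPolynomial.induction_on with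
  | C a => exact ⟨|a|, abs_nonneg a, 0, by simp⟩
  | add p q hp hq =>
    obtain ⟨C, hC, n, h⟩ := hp
    obtain ⟨D, hD, m, h'⟩ := hq
    refine ⟨C + D, by positivity, n + m, fun y => ?_⟩
    have h1 : (1 : ℝ) ≤ 1 + ‖y‖ := by linarith [norm_nonneg y]
    rw [map_add, add_mul]
    refine (abs_add_le _ _).trans (add_le_add ((h y).trans ?_) ((h' y).trans ?_)) <;>
    · gcongr
      · omega
  | mul_X p i hp =>
    obtain ⟨C, hC, n, h⟩ := hp
    refine ⟨C, hC, n + 1, fun y => ?_⟩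
    rw [map_mul, MvPolynomial.eval_X, abs_mul, pow_succ, ← mul_assoc]
    have : |y i| ≤ 1 + ‖y‖ := by
      have := norm_le_pi_norm y i
      rw [Real.norm_eq_abs] at this
      linarith
    gcongr
    exact h y

lemma gaussPoly_decay {d : ℕ} (P : MvPolynomial (Fin d) ℝ) (N : ℕ) :
    ∃ C : ℝ, 0 ≤ C ∧ ∀ y, |gaussPoly P y| * (1 + ‖y‖) ^ N ≤ C := by
  obtain ⟨C, hC, n, h⟩ := P.exists_abs_eval_le
  refine ⟨C * ((n + N).factorial * Real.exp (3 / 2)), by positivity, fun y => ?_⟩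
  set u := ‖y‖ with hu
  have hu0 : 0 ≤ u := norm_nonneg y
  have hsum : u ^ 2 ≤ ∑ i, y i ^ 2 := by
    have : u ≤ √(∑ i, y i ^ 2) := by
      refine (pi_norm_le_iff_of_nonneg (Real.sqrt_nonneg _)).2 fun i => ?_
      rw [Real.norm_eq_abs, ← Real.sqrt_sq_eq_abs]
      exact Real.sqrt_le_sqrt
        (Finset.single_le_sum (f := fun i => y i ^ 2) (fun _ _ => sq_nonneg _) (Finset.mem_univ i))
    exact (Real.le_sqrt hu0 (by positivity)).1 this
  have hexp : (1 + u) ^ (n + N) ≤ (n + N).factorial * Real.exp (1 + u) := by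
    have := Real.pow_div_factorial_le_exp (1 + u) (by positivity) (n + N)
    rwa [div_le_iff₀' (by positivity)] at this
  calc |gaussPoly P y| * (1 + u) ^ N
      ≤ C * (1 + u) ^ n * Real.exp (-(∑ i, y i ^ 2) / 2) * (1 + u) ^ N := by
        rw [gaussPoly, abs_mul, Real.abs_exp]
        gcongr
        exact h y
    _ = C * ((1 + u) ^ (n + N) * Real.exp (-(∑ i, y i ^ 2) / 2)) := by ring
    _ ≤ C * ((n + N).factorial * Real.exp (1 + u) * Real.exp (-(∑ i, y i ^ 2) / 2)) := by
        gcongr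
    _ = C * ((n + N).factorial * Real.exp (1 + u - (∑ i, y i ^ 2) / 2)) := by
        rw [mul_assoc, ← Real.exp_add]; ring_nf
    _ ≤ C * ((n + N).factorial * Real.exp (3 / 2)) := by
        gcongr
        nlinarith [sq_nonneg (u - 1)]

lemma hasFDerivAt_gaussPoly {d : ℕ} (P : MvPolynomial (Fin d) ℝ) (y : Fin d → ℝ) :
    HasFDerivAt (gaussPoly P)
      (∑ i, gaussPoly (gaussDeriv i P) y • ContinuousLinearMap.proj (R := ℝ) (φ := fun _ => ℝ) i)
      y := by
  have hexp : HasFDerivAt (fun y : Fin d → ℝ => Real.exp (-(∑ i, y i ^ 2) / 2))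
      (∑ i, (-(y i) * Real.exp (-(∑ i, y i ^ 2) / 2)) •
        ContinuousLinearMap.proj (R := ℝ) (φ := fun _ => ℝ) i) y := by
    have h1 : HasFDerivAt (fun y : Fin d → ℝ => ∑ i, y i ^ 2)
        (∑ i, (2 * y i) • ContinuousLinearMap.proj (R := ℝ) (φ := fun _ => ℝ) i) y := by
      refine HasFDerivAt.fun_sum fun i _ => ?_
      simpa using ((ContinuousLinearMap.proj (R := ℝ) (φ := fun _ : Fin d => ℝ) i).hasFDerivAt
        (x := y)).pow 2
    simp only [div_eq_mul_inv]
    refine (h1.fun_neg.mul_const (2 : ℝ)⁻¹).exp.congr_fderiv ?_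
    ext v
    simp [Finset.mul_sum]
    exact Finset.sum_congr rfl fun i _ => by ring
  have hpoly : HasFDerivAt (fun y : Fin d → ℝ => MvPolynomial.eval y P)
      (∑ i, MvPolynomial.eval y (MvPolynomial.pderiv i P) •
        ContinuousLinearMap.proj (R := ℝ) (φ := fun _ => ℝ) i) y := by
    induction P using MvPolynomial.induction_on with
    | C a => simpa using hasFDerivAt_const a y
    | add p q hp hq => 
      simp only [map_add]
      refine (hp.fun_add hq).congr_fderiv ?_
      simp [add_smul, Finset.sum_add_distrib]
    | mul_X p i hp =>
      simp only [map_mul, MvPolynomial.eval_X]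
      refine (hp.fun_mul ((ContinuousLinearMap.proj (R := ℝ) (φ := fun _ : Fin d => ℝ)
        i).hasFDerivAt (x := y))).congr_fderiv ?_
      ext v
      simp [MvPolynomial.pderiv_X, Pi.single_apply, add_mul, Finset.sum_add_distrib,
        apply_ite, Finset.mul_sum, mul_assoc]
  refine (hpoly.fun_mul hexp).congr_fderiv ?_
  ext v
  simp [gaussPoly, gaussDeriv, Finset.mul_sum, ← Finset.sum_neg_distrib]
  rw [← Finset.sum_add_distrib]
  exact Finset.sum_congr rfl fun i _ => by ring

lemma stdGaussian_eq_withDensity (d : ℕ) :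
    stdGaussian d = (volume : Measure (Fin d → ℝ)).withDensity
      (fun y => ENNReal.ofReal (∏ i, gaussianPDFReal 0 1 (y i))) := by
  refine Measure.pi_eq fun s hs => ?_
  have hint : Integrable (fun y : Fin d → ℝ => ∏ i, gaussianPDFReal 0 1 (y i)) volume :=
    Integrable.fintype_prod fun _ => integrable_gaussianPDFReal 0 1
  rw [withDensity_apply _ (MeasurableSet.univ_pi hs),
    ← ofReal_integral_eq_lintegral_ofReal hint.integrableOn
      (Filter.Eventually.of_forall fun y =>
        Finset.prod_nonneg fun i _ => gaussianPDFReal_nonneg 0 1 (y i)),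
    volume_pi, Measure.restrict_pi_pi,
    integral_fintype_prod_eq_prod (fun _ x => gaussianPDFReal 0 1 x),
    ENNReal.ofReal_prod_of_nonneg fun i _ =>
      integral_nonneg fun x => gaussianPDFReal_nonneg 0 1 x]
  exact Finset.prod_congr rfl fun i _ => (gaussianReal_apply_eq_integral 0 one_ne_zero (s i)).symm

lemma integral_stdGaussian_comp_add_smul {d : ℕ} (F : (Fin d → ℝ) → ℝ) (x : Fin d → ℝ) {a : ℝ}
    (ha : 0 < a) :
    ∫ y, F (x + a⁻¹ • y) ∂(stdGaussian d) =
      ((√(2 * Real.pi))⁻¹ * a) ^ d * ∫ z, F z * gaussPoly 1 (a • (z - x)) := by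
  have hdens : ∀ y : Fin d → ℝ, ∏ i, gaussianPDFReal 0 1 (y i) =
      (√(2 * Real.pi))⁻¹ ^ d * gaussPoly 1 y := fun y => by
    simp [gaussianPDFReal, gaussPoly, Finset.prod_mul_distrib, ← Real.exp_sum, neg_div,
      Finset.sum_div]
  rw [stdGaussian_eq_withDensity, integral_withDensity_eq_integral_toReal_smul (by
    have := (continuous_gaussPoly (d := d) 1).measurable
    simp_rw [hdens]; fun_prop) (Filter.Eventually.of_forall fun _ => ENNReal.ofReal_lt_top)]
  have hshift := integral_sub_right_eq_self (μ := (volume : Measure (Fin d → ℝ)))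
    (fun z => F (x + z) * gaussPoly 1 (a • z)) x
  have hscale := Measure.integral_comp_smul (volume : Measure (Fin d → ℝ))
    (fun y => F (x + a⁻¹ • y) * gaussPoly 1 y) a
  simp only [smul_smul, inv_mul_cancel₀ ha.ne', one_smul, Module.finrank_fin_fun,
    add_sub_cancel] at hshift hscale
  rw [hshift, hscale, abs_of_pos (by positivity), smul_eq_mul, ← integral_const_mul,
    ← integral_const_mul]
  refine integral_congr_ae (Filter.Eventually.of_forall fun y => ?_)
  simp only [smul_eq_mul]
  rw [ENNReal.toReal_ofReal (Finset.prod_nonneg fun i _ => gaussianPDFReal_nonneg 0 1 (y i)),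
    hdens]
  rw [mul_pow]
  field_simp

lemma gaussPoly_comp_le_integrable {d : ℕ} (P : MvPolynomial (Fin d) ℝ) {a₀ : ℝ} (ha₀ : 0 < a₀)
    (x₀ : Fin d → ℝ) :
    ∃ b : (Fin d → ℝ) → ℝ, Integrable b ∧ ∀ a, a₀ / 2 < a → ∀ x ∈ Metric.ball x₀ 1,
      ∀ z, |gaussPoly P (a • (z - x))| ≤ b z := by
  obtain ⟨C, hC, h⟩ := gaussPoly_decay P (d + 1)
  set K : ℝ := 2 + 2 / a₀ with hK
  have hK0 : 0 < K := by positivity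
  refine ⟨fun z => K ^ (d + 1) * C * (1 + ‖z - x₀‖) ^ (-((d + 1 : ℕ) : ℝ)), ?_, ?_⟩
  · have h1 := integrable_one_add_norm (μ := (volume : Measure (Fin d → ℝ)))
      (r := ((d + 1 : ℕ) : ℝ)) (by simp)
    exact (h1.comp_sub_right x₀).const_mul _
  · intro a ha x hx z
    have ha0 : 0 < a := by linarith [half_pos ha₀]
    have hy : ‖a • (z - x)‖ = a * ‖z - x‖ := by rw [norm_smul, Real.norm_of_nonneg ha0.le]
    have htri : ‖z - x₀‖ ≤ ‖z - x‖ + 1 := by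
      have := norm_sub_le_norm_sub_add_norm_sub z x x₀
      rw [mem_ball_iff_norm] at hx
      linarith
    have hle : 1 + ‖z - x₀‖ ≤ K * (1 + ‖a • (z - x)‖) := by
      have h1 : ‖z - x‖ ≤ 2 / a₀ * (a * ‖z - x‖) := by
        rw [← mul_assoc]
        refine le_mul_of_one_le_left (norm_nonneg _) ?_
        rw [div_mul_eq_mul_div, le_div_iff₀ ha₀]
        linarith
      have h2 : 0 ≤ a * ‖z - x‖ := by positivity
      have h3 : 0 ≤ 2 / a₀ := by positivity
      rw [hy, hK]
      nlinarith
    beta_reduce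
    rw [Real.rpow_neg (by positivity), Real.rpow_natCast, ← div_eq_mul_inv,
      le_div_iff₀ (by positivity)]
    calc |gaussPoly P (a • (z - x))| * (1 + ‖z - x₀‖) ^ (d + 1)
        ≤ |gaussPoly P (a • (z - x))| * (K * (1 + ‖a • (z - x)‖)) ^ (d + 1) := by gcongr
      _ = K ^ (d + 1) * (|gaussPoly P (a • (z - x))| * (1 + ‖a • (z - x)‖) ^ (d + 1)) := by
        rw [mul_pow]; ring
      _ ≤ K ^ (d + 1) * C := by gcongr; exact h _

/-- The convolution of `f` with the dilation by `a` of `gaussPoly P`. -/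
noncomputable def gaussConv {d : ℕ} (f : (Fin d → ℝ) → ℝ) (P : MvPolynomial (Fin d) ℝ) (a : ℝ)
    (x : Fin d → ℝ) : ℝ :=
  ∫ z, f z * gaussPoly P (a • (z - x))

section gaussConv

variable {d : ℕ} {f : (Fin d → ℝ) → ℝ} {B : ℝ}

lemma integrable_mul_gaussPoly (hf : Continuous f) (hB : ∀ z, |f z| ≤ B)
    (P : MvPolynomial (Fin d) ℝ) {a : ℝ} (ha : 0 < a) (x : Fin d → ℝ) :
    Integrable fun z => f z * gaussPoly P (a • (z - x)) := by
  obtain ⟨b, hb, h⟩ := gaussPoly_comp_le_integrable P ha x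
  have hP := continuous_gaussPoly P
  refine (hb.const_mul B).mono' (by fun_prop) (Filter.Eventually.of_forall fun z => ?_)
  rw [Real.norm_eq_abs, abs_mul]
  exact mul_le_mul (hB z) (h a (half_lt_self ha) x (Metric.mem_ball_self one_pos) z)
    (abs_nonneg _) ((abs_nonneg _).trans (hB z))

lemma hasFDerivAt_gaussConv_prod (hf : Continuous f) (hB : ∀ z, |f z| ≤ B)
    (P : MvPolynomial (Fin d) ℝ) {a : ℝ} (ha : 0 < a) (x : Fin d → ℝ) :
    HasFDerivAt (fun q : ℝ × (Fin d → ℝ) => gaussConv f P q.1 q.2)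
      (∑ i, ((a⁻¹ * gaussConv f (MvPolynomial.X i * gaussDeriv i P) a x) •
          ContinuousLinearMap.fst ℝ ℝ (Fin d → ℝ) -
        (a * gaussConv f (gaussDeriv i P) a x) •
          (ContinuousLinearMap.proj (R := ℝ) (φ := fun _ : Fin d => ℝ) i).comp
            (ContinuousLinearMap.snd ℝ ℝ (Fin d → ℝ)))) (a, x) := by
  have hB0 : 0 ≤ B := (abs_nonneg _).trans (hB x)
  have hcont := fun Q : MvPolynomial (Fin d) ℝ => continuous_gaussPoly Q
  choose b₁ hb₁ h₁ using fun i : Fin d =>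
    gaussPoly_comp_le_integrable (MvPolynomial.X i * gaussDeriv i P) ha x
  choose b₂ hb₂ h₂ using fun i : Fin d => gaussPoly_comp_le_integrable (gaussDeriv i P) ha x
  let F' : ℝ × (Fin d → ℝ) → (Fin d → ℝ) → (ℝ × (Fin d → ℝ) →L[ℝ] ℝ) := fun q z =>
    ∑ i, ((q.1⁻¹ * (f z * gaussPoly (MvPolynomial.X i * gaussDeriv i P) (q.1 • (z - q.2)))) •
          ContinuousLinearMap.fst ℝ ℝ (Fin d → ℝ) -
        (q.1 * (f z * gaussPoly (gaussDeriv i P) (q.1 • (z - q.2)))) •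
          (ContinuousLinearMap.proj (R := ℝ) (φ := fun _ : Fin d => ℝ) i).comp
            (ContinuousLinearMap.snd ℝ ℝ (Fin d → ℝ)))
  have hint₁ := fun i : Fin d => ((integrable_mul_gaussPoly hf hB
    (MvPolynomial.X i * gaussDeriv i P) ha x).const_mul a⁻¹).smul_const
      (ContinuousLinearMap.fst ℝ ℝ (Fin d → ℝ))
  have hint₂ := fun i : Fin d => ((integrable_mul_gaussPoly hf hB
    (gaussDeriv i P) ha x).const_mul a).smul_const
      ((ContinuousLinearMap.proj (R := ℝ) (φ := fun _ : Fin d => ℝ) i).comp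
            (ContinuousLinearMap.snd ℝ ℝ (Fin d → ℝ)))
  have key := hasFDerivAt_integral_of_dominated_of_fderiv_le (𝕜 := ℝ)
    (μ := (volume : Measure (Fin d → ℝ)))
    (F := fun (q : ℝ × (Fin d → ℝ)) z => f z * gaussPoly P (q.1 • (z - q.2)))
    (F' := F') (x₀ := (a, x)) (s := Set.Ioo (a / 2) (2 * a) ×ˢ Metric.ball x 1)
    (bound := fun z => ∑ i, (2 / a * (B * b₁ i z) + 2 * a * (B * b₂ i z)))
    (prod_mem_nhds (Ioo_mem_nhds (by linarith) (by linarith)) (Metric.ball_mem_nhds x one_pos))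
    (Filter.Eventually.of_forall fun q => by
      have := hcont P
      exact Continuous.aestronglyMeasurable (by fun_prop))
    (integrable_mul_gaussPoly hf hB P ha x)
    (integrable_finsetSum _ fun i _ => (hint₁ i).sub (hint₂ i)).aestronglyMeasurable
    (Filter.Eventually.of_forall fun z q hq => ?_)
    (integrable_finsetSum _ fun i _ =>
      (((hb₁ i).const_mul B).const_mul _).add (((hb₂ i).const_mul B).const_mul _))
    (Filter.Eventually.of_forall fun z q hq => ?_)
  · refine key.congr_fderiv ?_
    simp only [F']
    rw [integral_finsetSum _ fun i _ => by exact (hint₁ i).sub (hint₂ i)]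
    refine Finset.sum_congr rfl fun i _ => ?_
    rw [integral_sub (hint₁ i) (hint₂ i), integral_smul_const, integral_smul_const,
      integral_const_mul, integral_const_mul]
    rfl
  · obtain ⟨⟨hq1, hq2⟩, hq3⟩ := hq
    have hq0 : 0 < q.1 := by linarith [half_pos ha]
    refine (norm_sum_le _ _).trans (Finset.sum_le_sum fun i _ => ?_)
    refine (norm_sub_le _ _).trans (add_le_add ?_ ?_)
    · rw [norm_smul, norm_mul, norm_mul, Real.norm_eq_abs, Real.norm_eq_abs, Real.norm_eq_abs,
        abs_of_pos (inv_pos.2 hq0)]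
      have hb := h₁ i q.1 hq1 q.2 hq3 z
      have hb0 := (abs_nonneg _).trans hb
      have hinv : q.1⁻¹ ≤ 2 / a := by
        rw [inv_le_comm₀ hq0 (by positivity), inv_div]
        exact hq1.le
      calc _ ≤ (2 / a * (B * b₁ i z)) * 1 := by
            gcongr
            · exact hB z
            · exact ContinuousLinearMap.norm_fst_le ℝ ℝ (Fin d → ℝ)
        _ = _ := mul_one _
    · rw [norm_smul, norm_mul, norm_mul, Real.norm_eq_abs, Real.norm_eq_abs, Real.norm_eq_abs,
        abs_of_pos hq0]
      have hb := h₂ i q.1 hq1 q.2 hq3 z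
      have hb0 := (abs_nonneg _).trans hb
      calc _ ≤ (2 * a * (B * b₂ i z)) * 1 := by
            gcongr
            · exact hB z
            · refine ContinuousLinearMap.opNorm_le_bound _ zero_le_one fun v => ?_
              rw [one_mul]
              exact (norm_le_pi_norm v.2 i).trans (norm_snd_le v)
        _ = _ := mul_one _
  · have hq0 : 0 < q.1 := by linarith [half_pos ha, hq.1.1]
    have h1 : HasFDerivAt (fun q : ℝ × (Fin d → ℝ) => q.1 • (z - q.2)) _ q :=
      (hasFDerivAt_fst (𝕜 := ℝ) (p := q)).fun_smul ((hasFDerivAt_snd (𝕜 := ℝ) (p := q)).const_sub z)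
    refine (((hasFDerivAt_gaussPoly P (q.1 • (z - q.2))).comp q h1).const_mul (f z)).congr_fderiv ?_
    refine ContinuousLinearMap.ext fun v => ?_
    simp only [F', gaussPoly, ContinuousLinearMap.comp_apply, FunLike.coe_sum, Finset.sum_apply,
      FunLike.coe_smul, Pi.smul_apply, FunLike.coe_sub, Pi.sub_apply, smul_eq_mul, Finset.mul_sum]
    refine Finset.sum_congr rfl fun i _ => ?_
    simp
    field_simp
    ring

lemma hasFDerivAt_gaussConv (hf : Continuous f) (hB : ∀ z, |f z| ≤ B)
    (P : MvPolynomial (Fin d) ℝ) {a : ℝ} (ha : 0 < a) (x : Fin d → ℝ) :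
    HasFDerivAt (gaussConv f P a)
      (∑ i, (-(a * gaussConv f (gaussDeriv i P) a x)) •
        ContinuousLinearMap.proj (R := ℝ) (φ := fun _ : Fin d => ℝ) i) x := by
  refine ((hasFDerivAt_gaussConv_prod hf hB P ha x).comp x
    (hasFDerivAt_prodMk_right a x)).congr_fderiv ?_
  ext v
  simp

lemma hasDerivAt_gaussConv (hf : Continuous f) (hB : ∀ z, |f z| ≤ B)
    (P : MvPolynomial (Fin d) ℝ) {a : ℝ} (ha : 0 < a) (x : Fin d → ℝ) :
    HasDerivAt (fun a => gaussConv f P a x)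
      (∑ i, a⁻¹ * gaussConv f (MvPolynomial.X i * gaussDeriv i P) a x) a := by
  refine (HasFDerivAt.comp_hasDerivAt (f := fun a : ℝ => (a, x)) a
    (hasFDerivAt_gaussConv_prod hf hB P ha x)
    ((hasDerivAt_id a).prodMk (hasDerivAt_const a x))).congr_deriv ?_
  simp

lemma fderiv_gaussConv_single (hf : Continuous f) (hB : ∀ z, |f z| ≤ B)
    (P : MvPolynomial (Fin d) ℝ) {a : ℝ} (ha : 0 < a) (x : Fin d → ℝ) (i : Fin d) :
    fderiv ℝ (gaussConv f P a) x (Pi.single i 1) = -(a * gaussConv f (gaussDeriv i P) a x) := by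
  rw [(hasFDerivAt_gaussConv hf hB P ha x).fderiv]
  simp [Pi.single_apply]

lemma contDiff_gaussConv (hf : Continuous f) (hB : ∀ z, |f z| ≤ B)
    (P : MvPolynomial (Fin d) ℝ) {a : ℝ} (ha : 0 < a) (n : ℕ) :
    ContDiff ℝ n (gaussConv f P a) := by
  have hdiff := fun P : MvPolynomial (Fin d) ℝ =>
    fun x => (hasFDerivAt_gaussConv hf hB P ha x).differentiableAt
  induction n generalizing P with
  | zero => exact contDiff_zero.2 (Differentiable.continuous (𝕜 := ℝ) (hdiff P))
  | succ n ih =>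
    push_cast
    refine contDiff_succ_iff_fderiv.2 ⟨hdiff P, by simp, ?_⟩
    rw [funext fun x => (hasFDerivAt_gaussConv hf hB P ha x).fderiv]
    exact ContDiff.sum fun i _ => (contDiff_const.mul (ih _)).neg.smul contDiff_const

lemma gaussConv_gaussDeriv_gaussDeriv_one (hf : Continuous f) (hB : ∀ z, |f z| ≤ B)
    {a : ℝ} (ha : 0 < a) (x : Fin d → ℝ) (i : Fin d) :
    gaussConv f (gaussDeriv i (gaussDeriv i 1)) a x =
      -(gaussConv f 1 a x + gaussConv f (MvPolynomial.X i * gaussDeriv i 1) a x) := by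
  unfold gaussConv
  rw [← integral_add (integrable_mul_gaussPoly hf hB _ ha x)
    (integrable_mul_gaussPoly hf hB _ ha x), ← integral_neg]
  congr 1 with z
  simp [gaussPoly, gaussDeriv]
  ring

lemma lap'_const_mul_gaussConv_one (hf : Continuous f) (hB : ∀ z, |f z| ≤ B)
    {a : ℝ} (ha : 0 < a) (k : ℝ) (x : Fin d → ℝ) :
    lap' d (fun x => k * gaussConv f 1 a x) x =
      k * a ^ 2 * ∑ i, gaussConv f (gaussDeriv i (gaussDeriv i 1)) a x := by
  have hdiff := fun P : MvPolynomial (Fin d) ℝ =>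
    fun x => (hasFDerivAt_gaussConv hf hB P ha x).differentiableAt
  rw [lap', Finset.mul_sum]
  refine Finset.sum_congr rfl fun i _ => ?_
  have : (fun y => fderiv ℝ (fun x => k * gaussConv f 1 a x) y (Pi.single i 1)) =
      fun y => (-(k * a)) * gaussConv f (gaussDeriv i 1) a y := by
    ext y
    rw [fderiv_const_mul (hdiff 1 y), smul_apply, fderiv_gaussConv_single hf hB 1 ha,
      smul_eq_mul]
    ring
  rw [this, fderiv_const_mul (hdiff _ x), smul_apply, fderiv_gaussConv_single hf hB _ ha,
    smul_eq_mul]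
  ring

lemma hasDerivAt_pow_mul_gaussConv_one (hf : Continuous f) (hB : ∀ z, |f z| ≤ B)
    {a : ℝ} (ha : 0 < a) (c : ℝ) (x : Fin d → ℝ) :
    HasDerivAt (fun a => (c * a) ^ d * gaussConv f 1 a x)
      (-(a ^ 3)⁻¹ * lap' d (fun x => (c * a) ^ d * gaussConv f 1 a x) x) a := by
  refine ((((hasDerivAt_id a).const_mul c).fun_pow d).fun_mul
    (hasDerivAt_gaussConv hf hB 1 ha x)).congr_deriv ?_
  have hpow : (d : ℝ) * (c * a) ^ (d - 1) * c = d * (c * a) ^ d * a⁻¹ := by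
    rcases d with _ | d
    · simp
    · simp [pow_succ]
      field_simp
  rw [lap'_const_mul_gaussConv_one hf hB ha, id, mul_one, hpow, ← Finset.mul_sum]
  simp_rw [gaussConv_gaussDeriv_gaussDeriv_one hf hB ha]
  rw [Finset.sum_neg_distrib, Finset.sum_add_distrib, Finset.sum_const, Finset.card_univ,
    Fintype.card_fin, nsmul_eq_mul]
  field_simp

end gaussConv

section log

variable {d : ℕ} {u : (Fin d → ℝ) → ℝ}

lemma pderiv'_const_mul_log (hu : Differentiable ℝ u) (hpos : ∀ x, 0 < u x) (k : ℝ)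
    (x : Fin d → ℝ) (i : Fin d) :
    pderiv' d (fun x => k * Real.log (u x)) x i = k * (pderiv' d u x i / u x) := by
  rw [pderiv', (((hu x).hasFDerivAt.log (hpos x).ne').const_mul k).fderiv]
  simp [pderiv', div_eq_inv_mul]

lemma lap'_const_mul_log (hu : ContDiff ℝ 2 u) (hpos : ∀ x, 0 < u x) (k : ℝ) (x : Fin d → ℝ) :
    lap' d (fun x => k * Real.log (u x)) x =
      k * (lap' d u x / u x - (∑ i, pderiv' d u x i ^ 2) / u x ^ 2) := by
  have hu1 : Differentiable ℝ u := hu.differentiable two_ne_zero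
  have hdiff : ∀ i, Differentiable ℝ fun y => fderiv ℝ u y (Pi.single i 1) := fun i =>
    ((hu.fderiv_right (m := 1) (by norm_num)).clm_apply contDiff_const).differentiable one_ne_zero
  rw [lap', lap', Finset.sum_div, Finset.sum_div, ← Finset.sum_sub_distrib, Finset.mul_sum]
  refine Finset.sum_congr rfl fun i _ => ?_
  rw [show (fun y => fderiv ℝ (fun x => k * Real.log (u x)) y (Pi.single i 1)) =
    fun y => k * (fderiv ℝ u y (Pi.single i 1) / u y) from
      funext fun y => pderiv'_const_mul_log hu1 hpos k y i]
  have h := ((hdiff i x).hasFDerivAt.fun_mul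
    ((hasDerivAt_inv (hpos x).ne').comp_hasFDerivAt x (hu1 x).hasFDerivAt)).const_mul k
  have h' : HasFDerivAt (fun y => k * (fderiv ℝ u y (Pi.single i 1) / u y)) _ x := h
  rw [h'.fderiv]
  have := (hpos x).ne'
  simp [pderiv']
  field_simp
  ring

end log

/-- The Gaussian average of `f`, solving the backward heat equation
`∂_t w + (σ²/2) Δ w = 0` with terminal value `w(T,·) = f`. -/
noncomputable def gaussAverage {d : ℕ} (f : (Fin d → ℝ) → ℝ) (T σ t : ℝ) (x : Fin d → ℝ) : ℝ :=
  ∫ y, f (x + (σ * √(T - t)) • y) ∂(stdGaussian d)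

section gaussAverage

instance {d : ℕ} : IsProbabilityMeasure (stdGaussian d) := by
  unfold _root_.stdGaussian; infer_instance

variable {d : ℕ} {f : (Fin d → ℝ) → ℝ} {B T σ : ℝ}

lemma continuous_gaussAverage (hf : Continuous f) (hB : ∀ z, |f z| ≤ B) :
    Continuous fun p : ℝ × (Fin d → ℝ) => gaussAverage f T σ p.1 p.2 :=
  continuous_of_dominated (bound := fun _ => B)
    (fun _ => Continuous.aestronglyMeasurable (by fun_prop))
    (fun _ => Filter.Eventually.of_forall fun _ => hB _) (integrable_const B)
    (Filter.Eventually.of_forall fun _ => by fun_prop)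

lemma gaussAverage_self (x : Fin d → ℝ) : gaussAverage f T σ T x = f x := by
  simp [gaussAverage]

lemma gaussAverage_pos (hf : Continuous f) (hB : ∀ z, |f z| ≤ B) (hpos : ∀ z, 0 < f z) (t : ℝ)
    (x : Fin d → ℝ) : 0 < gaussAverage f T σ t x := by
  have hint : Integrable (fun y => f (x + (σ * √(T - t)) • y)) (stdGaussian d) :=
    (integrable_const B).mono' (Continuous.aestronglyMeasurable (by fun_prop))
      (Filter.Eventually.of_forall fun _ => hB _)
  refine (integral_pos_iff_support_of_nonneg (fun y => (hpos _).le) hint).2 ?_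
  rw [Function.support_eq_univ fun y => (hpos _).ne']
  simp

lemma gaussAverage_eq_gaussConv (hσ : 0 < σ) {t : ℝ} (ht : t < T) :
    gaussAverage f T σ t = fun x => ((√(2 * Real.pi))⁻¹ * (σ * √(T - t))⁻¹) ^ d *
      gaussConv f 1 (σ * √(T - t))⁻¹ x := by
  have ha : 0 < (σ * √(T - t))⁻¹ := inv_pos.2 (mul_pos hσ (Real.sqrt_pos.2 (sub_pos.2 ht)))
  ext x
  simpa only [gaussAverage, gaussConv, inv_inv] using integral_stdGaussian_comp_add_smul f x ha

lemma contDiff_gaussAverage (hf : Continuous f) (hB : ∀ z, |f z| ≤ B) (hσ : 0 < σ) {t : ℝ}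
    (ht : t < T) (n : ℕ) : ContDiff ℝ n (gaussAverage f T σ t) := by
  have ha : 0 < (σ * √(T - t))⁻¹ := inv_pos.2 (mul_pos hσ (Real.sqrt_pos.2 (sub_pos.2 ht)))
  rw [gaussAverage_eq_gaussConv hσ ht]
  exact contDiff_const.mul (contDiff_gaussConv hf hB 1 ha n)

lemma hasDerivAt_gaussAverage (hf : Continuous f) (hB : ∀ z, |f z| ≤ B) (hσ : 0 < σ) {t : ℝ}
    (ht : t < T) (x : Fin d → ℝ) :
    HasDerivAt (fun s => gaussAverage f T σ s x)
      (-(σ ^ 2 / 2) * lap' d (gaussAverage f T σ t) x) t := by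
  have hτ : 0 < T - t := sub_pos.2 ht
  have hs : 0 < √(T - t) := Real.sqrt_pos.2 hτ
  have ha : 0 < (σ * √(T - t))⁻¹ := inv_pos.2 (mul_pos hσ hs)
  have h1 := ((((hasDerivAt_id t).const_sub T).sqrt hτ.ne').const_mul σ).fun_inv
    (mul_pos hσ hs).ne'
  have h2 := HasDerivAt.comp t
    (hasDerivAt_pow_mul_gaussConv_one hf hB ha (√(2 * Real.pi))⁻¹ x) h1
  rw [gaussAverage_eq_gaussConv hσ ht]
  refine (h2.congr_of_eventuallyEq ?_).congr_deriv ?_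
  · filter_upwards [Iio_mem_nhds ht] with s hs
    rw [gaussAverage_eq_gaussConv hσ hs]
    rfl
  · simp only [id]
    field_simp

end gaussAverage

/-- The Cole–Hopf/Feynman–Kac reference solution
`v(t,x) = −rσ² log E[exp(−g(x+σ√(T−t)ξ)/(rσ²))]` is continuous on `[0,T] × ℝ^d`, smooth
enough on `[0,T) × ℝ^d`, solves the HJB equation
`∂_t v + (σ²/2) Δ v − (1/(2r))‖∇v‖² = 0` there, and satisfies `v(T,·) = g`. -/
theorem cole_hopf_reference_solution_HJB
    (d : ℕ) (T σ r : ℝ) (hT : 0 < T) (hσ : 0 < σ) (hr : 0 < r)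
    (g : (Fin d → ℝ) → ℝ) (hgc : Continuous g) (hgb : ∃ C, ∀ x, |g x| ≤ C)
    (v : ℝ → (Fin d → ℝ) → ℝ)
    (hv : v = fun t x => -(r * σ ^ 2) *
      Real.log (∫ y, Real.exp (-(1 / (r * σ ^ 2)) * g (x + (σ * Real.sqrt (T - t)) • y))
        ∂(stdGaussian d))) :
    ContinuousOn (fun p : ℝ × (Fin d → ℝ) => v p.1 p.2) (Set.Icc 0 T ×ˢ Set.univ) ∧
    (∀ t ∈ Set.Ico (0 : ℝ) T, ∀ x : Fin d → ℝ, DifferentiableAt ℝ (fun s => v s x) t) ∧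
    (∀ t ∈ Set.Ico (0 : ℝ) T, ContDiff ℝ 2 fun x => v t x) ∧
    (∀ t ∈ Set.Ico (0 : ℝ) T, ∀ x : Fin d → ℝ,
      deriv (fun s => v s x) t + σ ^ 2 / 2 * lap' d (v t) x
          - 1 / (2 * r) * ∑ i : Fin d, (pderiv' d (v t) x i) ^ 2 = 0) ∧
    (∀ x : Fin d → ℝ, v T x = g x) := by
  obtain ⟨C, hC⟩ := hgb
  set k : ℝ := r * σ ^ 2 with hk
  have hk0 : 0 < k := by positivity
  set f : (Fin d → ℝ) → ℝ := fun z => Real.exp (-(1 / k) * g z) with hf_def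
  have hf : Continuous f := by fun_prop
  have hpos : ∀ z, 0 < f z := fun z => Real.exp_pos _
  have hB : ∀ z, |f z| ≤ Real.exp (1 / k * C) := fun z => by
    rw [abs_of_pos (hpos z), Real.exp_le_exp, neg_mul, ← mul_neg]
    gcongr
    exact (neg_le_abs _).trans (hC z)
  have hv' : ∀ t, v t = fun x => -k * Real.log (gaussAverage f T σ t x) := fun t => by
    rw [hv]; rfl
  have hw := fun t x => gaussAverage_pos (T := T) (σ := σ) hf hB hpos t x
  have hderiv : ∀ t < T, ∀ x, HasDerivAt (fun s => v s x) (-k * (-(σ ^ 2 / 2) *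
      lap' d (gaussAverage f T σ t) x / gaussAverage f T σ t x)) t := fun t ht x => by
    simp only [hv']
    exact ((hasDerivAt_gaussAverage hf hB hσ ht x).log (hw t x).ne').const_mul _
  refine ⟨?_, fun t ht x => (hderiv t ht.2 x).differentiableAt, fun t ht => ?_,
    fun t ht x => ?_, fun x => ?_⟩
  · simp only [hv']
    exact (continuous_const.mul ((continuous_gaussAverage hf hB).log
      fun p => (hw p.1 p.2).ne')).continuousOn
  · rw [hv' t]
    exact contDiff_const.mul ((contDiff_gaussAverage hf hB hσ ht.2 2).log fun x => (hw t x).ne')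
  · have hu : ContDiff ℝ 2 (gaussAverage f T σ t) := contDiff_gaussAverage hf hB hσ ht.2 2
    rw [(hderiv t ht.2 x).deriv, hv' t, lap'_const_mul_log hu (hw t)]
    simp_rw [pderiv'_const_mul_log (hu.differentiable two_ne_zero) (hw t), mul_pow, div_pow]
    rw [← Finset.mul_sum, ← Finset.sum_div]
    have := (hw t x).ne'
    rw [hk]
    field_simp
    ring
  · simp only [hv', gaussAverage_self, hf_def, Real.log_exp]
    field_simp
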